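/- arXiv:1411.1514 — 3 statements merged into one kernel-verified Lean document; each statement's English description precedes it below -/
import Mathlib

section
/- Exponential formula for the Jacobi theta quotient: for every τ in the upper half-plane ℍ there exists ε > 0 such that for every real z with 0 < |z| < ε one has F(z,τ) = u · exp( − Σ_{k≥1} (−1)^k C_{2k}(τ) u^{2k} ), where u = 2πz and the series on the right converges absolutely. -/
open Complex

noncomputable section

/-- `q = exp(2πiτ)`. -/
def qnome (τ : ℂ) : ℂ := Complex.exp (2 * Real.pi * Complex.I * τ)

/-- `p = exp(2πiz)`. -/
def pvar (z : ℂ) : ℂ := Complex.exp (2 * Real.pi * Complex.I * z)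

/-- `σ_j(n) = ∑_{d ∣ n} d^j`. -/
def sigma' (j n : ℕ) : ℕ := ∑ d ∈ n.divisors, d ^ j

/-- The weight `2k` Eisenstein series
`E_{2k}(τ) = 1 − (4k/B_{2k}) ∑_{n ≥ 1} σ_{2k−1}(n) q^n`. -/
def Eis (k : ℕ) (τ : ℂ) : ℂ :=
  1 - (4 * k / ((bernoulli (2 * k) : ℚ) : ℂ)) *
    ∑' n : ℕ, (sigma' (2 * k - 1) (n + 1) : ℂ) * qnome τ ^ (n + 1)

/-- `C_{2k}(τ) = −(B_{2k}/(2k·(2k)!)) E_{2k}(τ)`. -/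
def Ck (k : ℕ) (τ : ℂ) : ℂ :=
  -(((bernoulli (2 * k) : ℚ) : ℂ) / ((2 * k : ℂ) * ((2 * k).factorial : ℂ))) * Eis k τ

/-- The Jacobi theta quotient
`F(z,τ) = −i (e^{πiz} − e^{−πiz}) ∏_{m ≥ 1} (1 − p q^m)(1 − p⁻¹ q^m)/(1 − q^m)²`. -/
def Fth (z τ : ℂ) : ℂ :=
  (-Complex.I) * (Complex.exp (Real.pi * Complex.I * z) - Complex.exp (-(Real.pi * Complex.I * z))) *
    ∏' m : ℕ, ((1 - pvar z * qnome τ ^ (m + 1)) * (1 - (pvar z)⁻¹ * qnome τ ^ (m + 1)) /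
      (1 - qnome τ ^ (m + 1)) ^ 2)

lemma aux_sigma (k : ℕ) {q : ℂ} (hq : ‖q‖ < 1) :
    ∑' p : ℕ × ℕ, ((p.2 : ℂ) + 1) ^ k * q ^ ((p.1 + 1) * (p.2 + 1)) =
      ∑' n : ℕ, (sigma' k (n + 1) : ℂ) * q ^ (n + 1) := by
  have h := tsum_prod_pow_eq_tsum_sigma k hq
  have hs := summable_prod_mul_pow k hq
  rw [← hs.tsum_prod] at h
  have e1 := (Equiv.prodCongr Equiv.pnatEquivNat Equiv.pnatEquivNat).symm.tsum_eq
    (fun c : ℕ+ × ℕ+ => ((c.2 : ℕ) : ℂ) ^ k * q ^ ((c.1 : ℕ) * (c.2 : ℕ)))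
  have e2 := tsum_pnat_eq_tsum_succ
    (f := fun n : ℕ => (ArithmeticFunction.sigma k n : ℂ) * q ^ n)
  rw [e2, ← e1] at h
  convert h using 2
  · ext p
    simp [Equiv.pnatEquivNat]
  · ext n
    simp [sigma', ArithmeticFunction.sigma_apply]

lemma aux_bern (k : ℕ) : (bernoulli (2 * (k + 1)) : ℚ) ≠ 0 := by
  intro h0
  have h := hasSum_zeta_nat (k := k + 1) (by omega)
  rw [h0] at h
  have h1 := h.summable.tsum_pos (fun n => by positivity) 1 (by simp)
  rw [h.tsum_eq] at h1
  simp at h1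

/-- the sine part -/
lemma aux_sin (z : ℝ) (hz : |z| < 1) (hz0 : z ≠ 0) : ∃ S : ℂ,
    HasSum (fun k : ℕ => (-1 : ℂ) ^ (k + 1) * ((bernoulli (2 * (k + 1)) : ℚ) : ℂ) /
      ((2 * (k + 1 : ℕ) : ℂ) * ((2 * (k + 1)).factorial : ℂ)) *
        (2 * (Real.pi : ℂ) * (z : ℂ)) ^ (2 * (k + 1))) S ∧
    Complex.sin (Real.pi * z) = Real.pi * z * Complex.exp S := by
  have hz2 : z ^ 2 < 1 := by rw [← sq_abs]; nlinarith [abs_nonneg z]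
  set G : ℕ × ℕ → ℂ := fun p =>
    -(((z : ℂ) ^ 2 / ((p.1 : ℂ) + 1) ^ 2) ^ (p.2 + 1) / ((p.2 : ℂ) + 1)) with hG
  have hnorm : ∀ n : ℕ, ‖(z : ℂ) ^ 2 / ((n : ℂ) + 1) ^ 2‖ = z ^ 2 / ((n : ℝ) + 1) ^ 2 := by
    intro n
    have : (z : ℂ) ^ 2 / ((n : ℂ) + 1) ^ 2 = ((z ^ 2 / ((n : ℝ) + 1) ^ 2 : ℝ) : ℂ) := by
      push_cast; rfl
    rw [this, Complex.norm_real, Real.norm_of_nonneg (by positivity)]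
  have hlt : ∀ n : ℕ, ‖(z : ℂ) ^ 2 / ((n : ℂ) + 1) ^ 2‖ < 1 := by
    intro n
    rw [hnorm, div_lt_one (by positivity)]
    have : (0 : ℝ) ≤ n := by positivity
    nlinarith
  have hsum : Summable G := by
    have h1 : Summable (fun n : ℕ => 1 / ((n : ℝ) + 1) ^ 2) := by
      have := (summable_nat_add_iff 1).mpr (Real.summable_one_div_nat_pow.mpr one_lt_two)
      simpa using this
    have h2 : Summable (fun k : ℕ => (z ^ 2) ^ (k + 1)) := by
      have := summable_geometric_of_lt_one (sq_nonneg z) hz2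
      exact (summable_nat_add_iff 1).mpr this
    have h3 := h1.mul_of_nonneg h2 (fun n => by positivity) (fun n => by positivity)
    refine Summable.of_norm_bounded h3 ?_
    rintro ⟨n, k⟩
    simp only [hG, norm_neg, norm_div, norm_pow]
    have e : ‖(k : ℂ) + 1‖ = (k : ℝ) + 1 := by exact_mod_cast Complex.norm_natCast (k + 1)
    have e' : ‖(n : ℂ) + 1‖ = (n : ℝ) + 1 := by exact_mod_cast Complex.norm_natCast (n + 1)
    rw [e, e', Complex.norm_real, Real.norm_eq_abs, sq_abs]
    have hn : (0 : ℝ) ≤ n := by positivity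
    have hk : (0 : ℝ) ≤ k := by positivity
    calc (z ^ 2 / ((n : ℝ) + 1) ^ 2) ^ (k + 1) / ((k : ℝ) + 1)
        ≤ (z ^ 2 / ((n : ℝ) + 1) ^ 2) ^ (k + 1) := div_le_self (by positivity) (by linarith)
      _ = (1 / ((n : ℝ) + 1) ^ 2) ^ (k + 1) * (z ^ 2) ^ (k + 1) := by
          rw [← mul_pow]; congr 1; ring
      _ ≤ 1 / ((n : ℝ) + 1) ^ 2 * (z ^ 2) ^ (k + 1) := by
          gcongr
          apply pow_le_of_le_one (by positivity) _ (by omega)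
          rw [div_le_one (by positivity)]
          nlinarith
  refine ⟨∑' p, G p, ?_, ?_⟩
  · have hs := (Equiv.prodComm ℕ ℕ).hasSum_iff.mpr hsum.hasSum
    refine hs.prod_fiberwise (fun k => ?_)
    have hb := hasSum_zeta_nat (k := k + 1) (by omega)
    have hb' := (hasSum_nat_add_iff' 1).mpr hb
    have hb2 := (Complex.hasSum_ofReal.mpr hb').mul_left (-((z : ℂ) ^ (2 * (k + 1)) / ((k : ℂ) + 1)))
    convert! hb2 using 1
    · ext n
      simp only [hG, Function.comp, Equiv.prodComm_apply, Prod.swap]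
      push_cast
      rw [div_pow, ← pow_mul, ← pow_mul]
      ring
    · have hf : ((2 * (k + 1)).factorial : ℂ) ≠ 0 := by
        exact_mod_cast Nat.factorial_ne_zero _
      have hk : (k : ℂ) + 1 ≠ 0 := by exact_mod_cast Nat.succ_ne_zero k
      have h2 : 2 * (k + 1) - 1 = 2 * k + 1 := by omega
      rw [h2]
      push_cast
      simp only [Finset.sum_range_one, Nat.cast_zero]
      have h3 : (0 : ℂ) ^ (2 * (k + 1)) = 0 := by simp
      push_cast
      rw [h3]
      field_simp
      ring
  · have h1 : HasSum (fun n : ℕ => Complex.log (1 - (z : ℂ) ^ 2 / ((n : ℂ) + 1) ^ 2))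
        (∑' p, G p) := by
      refine hsum.hasSum.prod_fiberwise (fun n => ?_)
      have := (Complex.hasSum_taylorSeries_neg_log' (hlt n)).neg
      rw [neg_neg] at this
      exact this
    have h2 : HasProd (fun n : ℕ => 1 - (z : ℂ) ^ 2 / ((n : ℂ) + 1) ^ 2)
        (Complex.exp (∑' p, G p)) := by
      refine Complex.hasProd_of_hasSum_log (fun n h => ?_) h1
      have := hlt n
      rw [sub_eq_zero] at h
      rw [← h] at this
      simp at this
    have h3 := h2.tendsto_prod_nat.const_mul ((Real.pi : ℂ) * z)
    exact tendsto_nhds_unique (Complex.tendsto_euler_sin_prod z) h3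

/-- the product part -/
lemma aux_prod (u : ℝ) (q : ℂ) (hq : ‖q‖ < 1) (hqu : Real.exp (2 * |u|) * ‖q‖ < 1) : ∃ S : ℂ,
    HasSum (fun k : ℕ => -2 * ((-1 : ℂ) ^ (k + 1) * (u : ℂ) ^ (2 * (k + 1)) /
        ((2 * (k + 1)).factorial : ℂ)) *
        ∑' n : ℕ, (sigma' (2 * (k + 1) - 1) (n + 1) : ℂ) * q ^ (n + 1)) S ∧
    HasProd (fun m : ℕ => (1 - Complex.exp (u * I) * q ^ (m + 1)) *
      (1 - (Complex.exp (u * I))⁻¹ * q ^ (m + 1)) / (1 - q ^ (m + 1)) ^ 2) (Complex.exp S) := by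
  set G : (ℕ × ℕ) × ℕ → ℂ := fun p =>
    -2 * ((-1 : ℂ) ^ (p.2 + 1) * ((u : ℂ) * ((p.1.2 : ℂ) + 1)) ^ (2 * (p.2 + 1)) /
      ((2 * (p.2 + 1)).factorial : ℂ)) / ((p.1.2 : ℂ) + 1) * q ^ ((p.1.1 + 1) * (p.1.2 + 1)) with hG
  have hsum : Summable G := by
    have h1 := summable_geometric_of_lt_one (norm_nonneg q) hq
    have h2 := summable_geometric_of_lt_one (by positivity) hqu
    have h2' := (summable_nat_add_iff 1).mpr h2
    have h3 := summable_geometric_of_lt_one (r := (1 / 4 : ℝ)) (by norm_num) (by norm_num)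
    have h4 := ((h1.mul_of_nonneg h2' (fun n => by positivity)
      (fun n => by positivity)).mul_of_nonneg h3 (fun n => by positivity)
      (fun n => by positivity)).mul_left 2
    refine Summable.of_norm_bounded h4 ?_
    rintro ⟨⟨m, d⟩, k⟩
    have e : ‖(d : ℂ) + 1‖ = (d : ℝ) + 1 := by exact_mod_cast Complex.norm_natCast (d + 1)
    have hd : (0 : ℝ) ≤ d := by positivity
    have hb := Real.pow_div_factorial_le_exp (2 * (|u| * ((d : ℝ) + 1))) (by positivity)
      (2 * (k + 1))
    have hp : ‖q‖ ^ ((m + 1) * (d + 1)) ≤ ‖q‖ ^ (m + (d + 1)) :=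
      pow_le_pow_of_le_one (norm_nonneg q) hq.le (by nlinarith [Nat.zero_le (m * d)])
    have hb2 : (|u| * ((d : ℝ) + 1)) ^ (2 * (k + 1)) / ((2 * (k + 1)).factorial : ℝ) ≤
        (1 / 4) ^ k * Real.exp (2 * |u|) ^ (d + 1) := by
      have e1 : Real.exp (2 * (|u| * ((d : ℝ) + 1))) = Real.exp (2 * |u|) ^ (d + 1) := by
        rw [← Real.exp_nat_mul]; congr 1; push_cast; ring
      rw [e1] at hb
      have e2 : (|u| * ((d : ℝ) + 1)) ^ (2 * (k + 1)) / ((2 * (k + 1)).factorial : ℝ) =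
        (1 / 4) ^ (k + 1) * ((2 * (|u| * ((d : ℝ) + 1))) ^ (2 * (k + 1)) /
          ((2 * (k + 1)).factorial : ℝ)) := by
        rw [mul_pow 2 (|u| * ((d : ℝ) + 1)), pow_mul 2 2 (k + 1), mul_div_assoc, ← mul_assoc,
          ← mul_pow]
        norm_num
      rw [e2]
      have e3 : (1 / 4 : ℝ) ^ (k + 1) ≤ (1 / 4) ^ k :=
        pow_le_pow_of_le_one (by norm_num) (by norm_num) (by omega)
      gcongr
    have e5 : ‖G ((m, d), k)‖ = 2 * ((|u| * ((d : ℝ) + 1)) ^ (2 * (k + 1)) /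
        ((2 * (k + 1)).factorial : ℝ)) / ((d : ℝ) + 1) * ‖q‖ ^ ((m + 1) * (d + 1)) := by
      simp only [hG, norm_mul, norm_div, norm_pow, norm_neg, e, Complex.norm_real,
        Real.norm_eq_abs, Complex.norm_natCast, norm_one, one_pow, one_mul, Complex.norm_ofNat]
    rw [e5]
    calc _ ≤ 2 * ((|u| * ((d : ℝ) + 1)) ^ (2 * (k + 1)) /
        ((2 * (k + 1)).factorial : ℝ)) * ‖q‖ ^ ((m + 1) * (d + 1)) := by
          gcongr
          exact div_le_self (by positivity) (by linarith)
      _ ≤ 2 * ((1 / 4) ^ k * Real.exp (2 * |u|) ^ (d + 1)) * ‖q‖ ^ (m + (d + 1)) := by gcongr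
      _ = _ := by simp only [mul_pow, pow_add]; ring
  refine ⟨∑' p, G p, ?_, ?_⟩
  · have hs := (Equiv.prodComm ℕ (ℕ × ℕ)).hasSum_iff.mpr hsum.hasSum
    refine hs.prod_fiberwise (fun k => ?_)
    have hf := (hs.summable.prod_factor k).hasSum
    convert! hf using 1
    rw [← aux_sigma _ hq, ← tsum_mul_left]
    refine tsum_congr fun p => ?_
    simp only [hG, Function.comp, Equiv.prodComm_apply, Prod.swap]
    have hk : (p.2 : ℂ) + 1 ≠ 0 := by exact_mod_cast Nat.succ_ne_zero p.2
    have h2 : 2 * (k + 1) = 2 * (k + 1) - 1 + 1 := by omega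
    have h3 : ((p.2 : ℂ) + 1) ^ (2 * (k + 1)) =
        ((p.2 : ℂ) + 1) ^ (2 * (k + 1) - 1) * ((p.2 : ℂ) + 1) := by
      rw [← pow_succ, ← h2]
    rw [mul_pow, h3]
    field_simp
  · set P := Complex.exp (u * I) with hP
    have hPn : ‖P‖ = 1 := Complex.norm_exp_ofReal_mul_I u
    have hPi : ‖P⁻¹‖ = 1 := by rw [norm_inv, hPn, inv_one]
    have hqm : ∀ m : ℕ, ‖q ^ (m + 1)‖ < 1 := fun m => by
      rw [norm_pow]; exact pow_lt_one₀ (norm_nonneg q) hq (by omega)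
    have l1 : ∀ m : ℕ, ‖P * q ^ (m + 1)‖ < 1 := fun m => by
      rw [norm_mul, hPn, one_mul]; exact hqm m
    have l2 : ∀ m : ℕ, ‖P⁻¹ * q ^ (m + 1)‖ < 1 := fun m => by
      rw [norm_mul, hPi, one_mul]; exact hqm m
    have hne : ∀ x : ℂ, ‖x‖ < 1 → 1 - x ≠ 0 := by
      intro x hx h
      rw [sub_eq_zero] at h
      rw [← h] at hx
      simp at hx
    have s1 : HasSum (fun p : ℕ × ℕ => -2 * (Complex.cos (u * ((p.2 : ℂ) + 1)) - 1) /
        ((p.2 : ℂ) + 1) * q ^ ((p.1 + 1) * (p.2 + 1))) (∑' p, G p) := by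
      refine hsum.hasSum.prod_fiberwise (fun p => ?_)
      have hc := (hasSum_nat_add_iff' 1).mpr (Complex.hasSum_cos (u * ((p.2 : ℂ) + 1)))
      have := ((hc.mul_left (-2)).div_const ((p.2 : ℂ) + 1)).mul_right
        (q ^ ((p.1 + 1) * (p.2 + 1)))
      simpa [hG] using this
    have s2 : HasSum (fun m : ℕ => Complex.log (1 - P * q ^ (m + 1)) +
        Complex.log (1 - P⁻¹ * q ^ (m + 1)) - 2 * Complex.log (1 - q ^ (m + 1)))
        (∑' p, G p) := by
      refine s1.prod_fiberwise (fun m => ?_)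
      have a1 := (Complex.hasSum_taylorSeries_neg_log' (l1 m)).neg
      have a2 := (Complex.hasSum_taylorSeries_neg_log' (l2 m)).neg
      have a3 := ((Complex.hasSum_taylorSeries_neg_log' (hqm m)).neg).mul_left 2
      have a4 := (a1.add a2).sub a3
      simp only [neg_neg] at a4
      convert! a4 using 1
      ext d
      have c1 : Complex.cos (u * ((d : ℂ) + 1)) = (P ^ (d + 1) + P⁻¹ ^ (d + 1)) / 2 := by
        rw [Complex.cos, hP, ← Complex.exp_neg, ← Complex.exp_nat_mul, ← Complex.exp_nat_mul]
        congr 3 <;> push_cast <;> ring_nf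
      simp only []
      rw [c1, pow_mul, mul_pow, mul_pow]
      ring
    have s3 := s2.cexp
    convert! s3 using 1
    ext m
    simp only [Function.comp]
    rw [Complex.exp_sub, Complex.exp_add, Complex.exp_log (hne _ (l1 m)),
      Complex.exp_log (hne _ (l2 m)), two_mul, Complex.exp_add, Complex.exp_log (hne _ (hqm m)), sq]

/-- Exponential formula for the Jacobi theta quotient: for every `τ` in the upper half-plane
there is `ε > 0` such that for all real `z` with `0 < |z| < ε`,
`F(z,τ) = u · exp(−∑_{k ≥ 1} (−1)^k C_{2k}(τ) u^{2k})` with `u = 2πz`, the series converging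
absolutely. -/
theorem theta_quotient_exp_formula (τ : ℂ) (hτ : 0 < τ.im) :
    ∃ ε > 0, ∀ z : ℝ, 0 < |z| → |z| < ε →
      (Summable fun k : ℕ =>
        ‖(-1 : ℂ) ^ (k + 1) * Ck (k + 1) τ * (2 * (Real.pi : ℂ) * (z : ℂ)) ^ (2 * (k + 1))‖) ∧
      Fth z τ = (2 * (Real.pi : ℂ) * (z : ℂ)) *
        Complex.exp (-∑' k : ℕ,
          (-1 : ℂ) ^ (k + 1) * Ck (k + 1) τ * (2 * (Real.pi : ℂ) * (z : ℂ)) ^ (2 * (k + 1))) := by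
  refine ⟨min (1 / 2) (τ.im / 2), by positivity, fun z hz0 hz => ?_⟩
  have hz1 : |z| < 1 := by linarith [min_le_left (1 / 2) (τ.im / 2)]
  have hz2 : |z| < τ.im / 2 := lt_of_lt_of_le hz (min_le_right _ _)
  have hzne : z ≠ 0 := abs_pos.mp hz0
  have hqn : ‖qnome τ‖ = Real.exp (-(2 * Real.pi * τ.im)) := by
    rw [qnome, Complex.norm_exp]; congr 1; simp
  have hpi := Real.pi_pos
  have hq : ‖qnome τ‖ < 1 := by
    rw [hqn, Real.exp_lt_one_iff]; nlinarith [mul_pos hpi hτ]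
  have hqu : Real.exp (2 * |2 * Real.pi * z|) * ‖qnome τ‖ < 1 := by
    rw [hqn, ← Real.exp_add, Real.exp_lt_one_iff, abs_mul, abs_of_pos (by positivity)]
    nlinarith [mul_lt_mul_of_pos_left hz2 hpi]
  obtain ⟨S, hS, hsin⟩ := aux_sin z hz1 hzne
  obtain ⟨T, hT, hprod⟩ := aux_prod (2 * Real.pi * z) (qnome τ) hq hqu
  have key : HasSum (fun k : ℕ =>
      (-1 : ℂ) ^ (k + 1) * Ck (k + 1) τ * (2 * (Real.pi : ℂ) * (z : ℂ)) ^ (2 * (k + 1)))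
      (-(S + T)) := by
    convert! (hS.add hT).neg using 1
    ext k
    have hB : ((bernoulli (2 * (k + 1)) : ℚ) : ℂ) ≠ 0 := by exact_mod_cast aux_bern k
    have hf : ((2 * (k + 1)).factorial : ℂ) ≠ 0 := by
      exact_mod_cast Nat.factorial_ne_zero _
    have hk : (k : ℂ) + 1 ≠ 0 := by exact_mod_cast Nat.succ_ne_zero k
    simp only [Ck, Eis]
    push_cast
    generalize (∑' n : ℕ, (sigma' (2 * (k + 1) - 1) (n + 1) : ℂ) * qnome τ ^ (n + 1)) = X
    field_simp
    ring
  refine ⟨key.summable.norm, ?_⟩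
  rw [key.tsum_eq, neg_neg, Complex.exp_add, Fth]
  have hpv : pvar z = Complex.exp (((2 * Real.pi * z : ℝ) : ℂ) * I) := by
    rw [pvar]; congr 1; push_cast; ring
  rw [hpv, hprod.tprod_eq]
  have h2 : (-Complex.I) * (Complex.exp (Real.pi * Complex.I * z) -
      Complex.exp (-(Real.pi * Complex.I * z))) = 2 * Complex.sin (Real.pi * z) := by
    rw [Complex.sin]
    have e1 : (Real.pi : ℂ) * I * z = Real.pi * z * I := by ring
    rw [e1, neg_mul]
    ring
  rw [h2, hsin]
  ring

end
end

section
/- Two expansions of the Weierstrass ℘-function agree: for every τ in the upper half-plane ℍ there exists ε > 0 such that for every real z with 0 < |z| < ε one has −1/u² − Σ_{k≥2} (−1)^k (2k−1)·2k· C_{2k}(τ) u^{2k−2} = 1/12 + p/(1−p)² + Σ_{k,r≥1} k (p^k − 2 + p^{−k}) q^{kr}, both series converging absolutely there. -/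
open Complex

noncomputable section

lemma aux_bound_summable (a ρ : ℝ) (ha0 : 0 ≤ a) (ha : a < 1) (hρ0 : 1 ≤ ρ) (hρ : ρ * a < 1) :
    Summable fun kr : ℕ × ℕ => ((kr.1 + 1 : ℕ) : ℝ) * ρ ^ (kr.1 + 1) *
      a ^ ((kr.1 + 1) * (kr.2 + 1)) := by
  have hρa : 0 ≤ ρ * a := by positivity
  have h1 : Summable fun k : ℕ => ((k + 1 : ℕ) : ℝ) * (ρ * a) ^ (k + 1) := by
    have := summable_pow_mul_geometric_of_norm_lt_one 1 (r := ρ * a)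
      (by rwa [Real.norm_of_nonneg hρa])
    have := (summable_nat_add_iff 1).mpr this
    simpa using this
  have h2 : Summable fun r : ℕ => a ^ r := summable_geometric_of_lt_one ha0 ha
  have h3 := h1.mul_of_nonneg h2 (fun k => by positivity) (fun r => by positivity)
  refine Summable.of_nonneg_of_le (fun kr => by positivity) (fun kr => ?_) h3
  rw [mul_pow, mul_assoc, mul_assoc, mul_assoc, ← pow_add]
  refine mul_le_mul_of_nonneg_left (mul_le_mul_of_nonneg_left ?_ (by positivity)) (by positivity)
  exact pow_le_pow_of_le_one ha0 ha.le (by nlinarith [Nat.zero_le (kr.1 * kr.2)])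

lemma aux_hasSum_cos_sub (w : ℂ) :
    HasSum (fun j : ℕ => (-1 : ℂ) ^ j * w ^ (2 * j + 2) / ((2 * j + 2).factorial : ℂ))
      (1 - Complex.cos w) := by
  have h := (hasSum_nat_add_iff' 1).mpr (Complex.hasSum_cos w)
  have h := h.neg
  simp only [Finset.range_one, Finset.sum_singleton, pow_zero, mul_zero, Nat.factorial_zero] at h
  convert! h using 1
  · ext j
    rw [pow_succ, mul_add]
    ring
  · simp

lemma aux_hasSum_cosh_sub (w : ℝ) :
    HasSum (fun j : ℕ => w ^ (2 * j + 2) / ((2 * j + 2).factorial : ℝ))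
      (Real.cosh w - 1) := by
  have h := (hasSum_nat_add_iff' 1).mpr (Real.hasSum_cosh w)
  simpa [mul_add] using h

/-- the double series -/
lemma aux_double (q : ℂ) (u : ℂ) (hq : ‖q‖ < 1) (hu : Real.exp ‖u‖ * ‖q‖ < 1) :
    Summable fun x : (ℕ × ℕ) × ℕ =>
      ‖((x.1.1 + 1 : ℕ) : ℂ) * q ^ ((x.1.1 + 1) * (x.1.2 + 1)) *
        (2 * ((-1 : ℂ) ^ x.2 * (((x.1.1 + 1 : ℕ) : ℂ) * u) ^ (2 * x.2 + 2) /
          ((2 * x.2 + 2).factorial : ℂ)))‖ := by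
  have key : ∀ k r : ℕ, HasSum (fun j : ℕ => 
      ‖((k + 1 : ℕ) : ℂ) * q ^ ((k + 1) * (r + 1)) *
        (2 * ((-1 : ℂ) ^ j * (((k + 1 : ℕ) : ℂ) * u) ^ (2 * j + 2) /
          ((2 * j + 2).factorial : ℂ)))‖)
      (((k + 1 : ℕ) : ℝ) * ‖q‖ ^ ((k + 1) * (r + 1)) * 
        (2 * (Real.cosh (((k + 1 : ℕ) : ℝ) * ‖u‖) - 1))) := by
    intro k r
    have := ((aux_hasSum_cosh_sub (((k + 1 : ℕ) : ℝ) * ‖u‖)).mul_left 2).mul_left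
      (((k + 1 : ℕ) : ℝ) * ‖q‖ ^ ((k + 1) * (r + 1)))
    convert! this using 2 with j
    simp only [norm_mul, norm_div, norm_pow, norm_neg, norm_one, one_pow, one_mul,
      Complex.norm_natCast, Complex.norm_ofNat]
  rw [summable_prod_of_nonneg (fun x => norm_nonneg _)]
  refine ⟨fun kr => (key kr.1 kr.2).summable, ?_⟩
  have hb := (aux_bound_summable ‖q‖ (Real.exp ‖u‖) (norm_nonneg _) hq
    (Real.one_le_exp (norm_nonneg _)) hu).mul_left 2
  refine Summable.of_nonneg_of_le (fun kr => tsum_nonneg fun j => norm_nonneg _) (fun kr => ?_) hb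
  rw [(key kr.1 kr.2).tsum_eq, ← Real.exp_nat_mul]
  have : 2 * (Real.cosh (((kr.1 + 1 : ℕ) : ℝ) * ‖u‖) - 1) ≤
      2 * Real.exp (((kr.1 + 1 : ℕ) : ℝ) * ‖u‖) := by
    rw [Real.cosh_eq]
    have h1 : 0 ≤ ((kr.1 + 1 : ℕ) : ℝ) * ‖u‖ := by positivity
    have h2 : Real.exp (-(((kr.1 + 1 : ℕ) : ℝ) * ‖u‖)) ≤ 1 := Real.exp_le_one_iff.mpr (by linarith)
    have h3 := Real.exp_pos (((kr.1 + 1 : ℕ) : ℝ) * ‖u‖)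
    linarith
  calc _ ≤ ((kr.1 + 1 : ℕ) : ℝ) * ‖q‖ ^ ((kr.1 + 1) * (kr.2 + 1)) *
        (2 * Real.exp (((kr.1 + 1 : ℕ) : ℝ) * ‖u‖)) := by gcongr
    _ = _ := by ring

lemma aux_sigma_sum (q : ℂ) (hq : ‖q‖ < 1) (m : ℕ) :
    HasSum (fun kr : ℕ × ℕ => ((kr.1 + 1 : ℕ) : ℂ) ^ m * q ^ ((kr.1 + 1) * (kr.2 + 1)))
      (∑' n : ℕ, ((∑ d ∈ (n + 1).divisors, d ^ m : ℕ) : ℂ) * q ^ (n + 1)) := by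
  have h1 := tsum_prod_pow_eq_tsum_sigma m hq
  have hs := summable_prod_mul_pow m hq
  have h2 : ∑' n : ℕ, ((∑ d ∈ (n + 1).divisors, d ^ m : ℕ) : ℂ) * q ^ (n + 1) =
     ∑' c : (ℕ+ × ℕ+), (c.2 : ℂ) ^ m * (q ^ (c.1 * c.2 : ℕ)) := by
    rw [hs.tsum_prod, h1, tsum_pnat_eq_tsum_succ (f := fun e : ℕ => (ArithmeticFunction.sigma m e : ℂ) * q ^ e)]
    simp [ArithmeticFunction.sigma_apply]
  rw [h2]
  have h3 := hs.hasSum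
  let e : ℕ × ℕ ≃ ℕ+ × ℕ+ := (Equiv.prodComm ℕ ℕ).trans (Equiv.prodCongr Equiv.pnatEquivNat.symm Equiv.pnatEquivNat.symm)
  have h4 := e.hasSum_iff.mpr h3
  convert! h4 using 2 with kr
  simp [e, mul_comm]

/-- `ζ(2m+2)` -/
noncomputable def auxZ (m : ℕ) : ℂ := ∑' n : ℕ, 1 / ((n : ℂ) + 1) ^ (2 * m + 2)

lemma auxZ_hasSum (m : ℕ) : HasSum (fun n : ℕ => 1 / ((n : ℝ) + 1) ^ (2 * m + 2))
    ((-1 : ℝ) ^ m * (2 : ℝ) ^ (2 * m + 1) * Real.pi ^ (2 * m + 2) *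
        bernoulli (2 * m + 2) / (2 * m + 2).factorial) := by
  have h := hasSum_zeta_nat (k := m + 1) (by omega)
  have h := (hasSum_nat_add_iff' 1).mpr h
  simp only [Finset.range_one, Finset.sum_singleton] at h
  convert! h using 1
  · simp [mul_add]
  · have : 2 * (m + 1) - 1 = 2 * m + 1 := by omega
    rw [this]
    simp [mul_add, pow_add]

lemma auxZ_eq (m : ℕ) : auxZ m = (-1 : ℂ) ^ m * (2 : ℂ) ^ (2 * m + 1) * (Real.pi : ℂ) ^ (2 * m + 2) *
        ((bernoulli (2 * m + 2) : ℚ) : ℂ) / ((2 * m + 2).factorial : ℂ) := by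
  have h := (Complex.hasSum_ofReal.mpr (auxZ_hasSum m)).tsum_eq
  unfold auxZ
  push_cast at h
  exact h

lemma aux_bernoulli_ne_zero (m : ℕ) : bernoulli (2 * m + 2) ≠ 0 := by
  intro h0
  have h := auxZ_hasSum m
  rw [h0] at h
  have h1 := h.summable.tsum_pos (fun n => by positivity) 0 (by norm_num)
  rw [h.tsum_eq] at h1
  simp at h1

lemma aux_summable (r : ℝ) (h0 : 0 ≤ r) (h1 : r < 1) :
    Summable fun p : ℕ × ℕ => r ^ p.2 * (1 / ((p.1 : ℝ) + 1) ^ (2 * p.2 + 2)) := by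
  have ha : Summable fun n : ℕ => 1 / ((n : ℝ) + 1) ^ (2 * 0 + 2) := (auxZ_hasSum 0).summable
  have hb : Summable fun m : ℕ => r ^ m := summable_geometric_of_lt_one h0 h1
  have := ha.mul_of_nonneg hb (fun n => by positivity) (fun m => by positivity)
  refine Summable.of_nonneg_of_le (fun p => by positivity) (fun p => ?_) this
  rw [mul_comm]
  gcongr ?_ * _
  apply one_div_le_one_div_of_le (by positivity)
  exact pow_le_pow_right₀ (by linarith [(Nat.cast_nonneg p.1 : (0:ℝ) ≤ p.1)]) (by omega)

lemma auxZ_norm_le (m : ℕ) : ‖auxZ m‖ ≤ ∑' n : ℕ, 1 / ((n : ℝ) + 1) ^ (2 * 0 + 2) := by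
  have e : ∀ n : ℕ, ‖1 / ((n : ℂ) + 1) ^ (2 * m + 2)‖ = 1 / ((n : ℝ) + 1) ^ (2 * m + 2) := by
    intro n
    have : ‖(n : ℂ) + 1‖ = (n : ℝ) + 1 := by
      exact_mod_cast Complex.norm_natCast (n + 1)
    rw [norm_div, norm_pow, this, norm_one]
  unfold auxZ
  refine (norm_tsum_le_tsum_norm (by simpa only [e] using (auxZ_hasSum m).summable)).trans ?_
  simp only [e]
  refine (auxZ_hasSum m).summable.tsum_le_tsum (fun n => ?_) (auxZ_hasSum 0).summable
  apply one_div_le_one_div_of_le (by positivity)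
  exact pow_le_pow_right₀ (by linarith [(Nat.cast_nonneg n : (0:ℝ) ≤ n)]) (by omega)

lemma aux_cot (x : ℂ) (hx1 : ‖x‖ < 1) :
    ∑' n : ℕ, (1 / (x - (n + 1)) + 1 / (x + (n + 1))) =
      ∑' m : ℕ, -2 * auxZ m * x ^ (2 * m + 1) := by
  have hr : ‖x‖ ^ 2 < 1 := by nlinarith [norm_nonneg x]
  have hs : Summable fun p : ℕ × ℕ => (-2 * x) * ((x ^ 2) ^ p.2 * (1 / ((p.1 : ℂ) + 1) ^ (2 * p.2 + 2))) := by
    apply Summable.mul_left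
    apply Summable.of_norm
    convert! aux_summable (‖x‖ ^ 2) (by positivity) hr using 2 with p
    have : ‖(p.1 : ℂ) + 1‖ = (p.1 : ℝ) + 1 := by
      exact_mod_cast Complex.norm_natCast (p.1 + 1)
    rw [norm_mul, norm_div, norm_pow, norm_pow, norm_pow, this, norm_one]
  have hf : ∀ n : ℕ, HasSum (fun m : ℕ => (-2 * x) * ((x ^ 2) ^ m * (1 / ((n : ℂ) + 1) ^ (2 * m + 2))))
      (1 / (x - (n + 1)) + 1 / (x + (n + 1))) := by
    intro n
    have hn : ‖(n : ℂ) + 1‖ = (n : ℝ) + 1 := by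
      exact_mod_cast Complex.norm_natCast (n + 1)
    have hn1 : (1 : ℝ) ≤ (n : ℝ) + 1 := by linarith [(Nat.cast_nonneg n : (0:ℝ) ≤ n)]
    have hn0 : (n : ℂ) + 1 ≠ 0 := by
      rw [← norm_ne_zero_iff, hn]; positivity
    have ha : x - (n + 1) ≠ 0 := by
      intro h
      rw [sub_eq_zero] at h
      rw [h, hn] at hx1
      linarith
    have hb : x + (n + 1) ≠ 0 := by
      intro h
      rw [add_eq_zero_iff_eq_neg] at h
      rw [h, norm_neg, hn] at hx1
      linarith
    have hg := hasSum_geometric_of_norm_lt_one (ξ := (x / (n + 1)) ^ 2) (by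
      rw [norm_pow, norm_div, hn]
      have : ‖x‖ / ((n : ℝ) + 1) < 1 := by rw [div_lt_one (by positivity)]; linarith
      exact pow_lt_one₀ (by positivity) this (by norm_num))
    have hg := hg.mul_left (-2 * x / ((n : ℂ) + 1) ^ 2)
    convert! hg using 1
    · ext m
      rw [← pow_mul, ← pow_mul, div_pow, pow_add]
      field_simp
    · have hc : ((n : ℂ) + 1) ^ 2 - x ^ 2 ≠ 0 := by
        have : ((n : ℂ) + 1) ^ 2 - x ^ 2 = -((x - (n + 1)) * (x + (n + 1))) := by ring
        rw [this]
        exact neg_ne_zero.mpr (mul_ne_zero ha hb)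
      have hd : 1 - (x / ((n : ℂ) + 1)) ^ 2 = (((n : ℂ) + 1) ^ 2 - x ^ 2) / ((n : ℂ) + 1) ^ 2 := by
        field_simp
      rw [hd, one_div_add_one_div ha hb, inv_div, div_mul_div_comm]
      rw [div_eq_div_iff (mul_ne_zero ha hb) (by positivity)]
      ring
  rw [tsum_congr fun n => (hf n).tsum_eq.symm, ← Summable.tsum_comm (f := fun n m : ℕ =>
    (-2 * x) * ((x ^ 2) ^ m * (1 / ((n : ℂ) + 1) ^ (2 * m + 2)))) hs]
  refine tsum_congr fun m => ?_
  simp only [tsum_mul_left]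
  rw [auxZ]
  ring

lemma aux_summable_deriv (r : ℝ) (h0 : 0 ≤ r) (h1 : r < 1) :
    Summable fun m : ℕ => 2 * (∑' n : ℕ, 1 / ((n : ℝ) + 1) ^ (2 * 0 + 2)) * 
      ((2 * (m : ℝ) + 1) * r ^ (2 * m)) := by
  apply Summable.mul_left
  have hr : ‖r ^ 2‖ < 1 := by rw [Real.norm_of_nonneg (by positivity)]; nlinarith
  have a := (summable_pow_mul_geometric_of_norm_lt_one 1 hr).mul_left 2
  have b := (summable_geometric_of_norm_lt_one hr)
  refine (a.add b).congr fun m => ?_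
  rw [pow_mul]; ring

lemma aux_deriv_bound (r : ℝ) (y : ℂ) (hy : ‖y‖ ≤ r) (m : ℕ) :
    ‖-2 * auxZ m * ((2 * (m : ℂ) + 1) * y ^ (2 * m))‖ ≤
      2 * (∑' n : ℕ, 1 / ((n : ℝ) + 1) ^ (2 * 0 + 2)) * ((2 * (m : ℝ) + 1) * r ^ (2 * m)) := by
  have : ‖2 * (m : ℂ) + 1‖ = 2 * (m : ℝ) + 1 := by
    exact_mod_cast Complex.norm_natCast (2 * m + 1)
  rw [norm_mul, norm_mul, norm_mul, norm_pow, this, norm_neg, Complex.norm_ofNat]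
  have := auxZ_norm_le m
  gcongr

lemma aux_sin_series (x : ℂ) (hx0 : x ≠ 0) (hx1 : ‖x‖ < 1) :
    HasSum (fun m : ℕ => -2 * auxZ m * ((2 * (m : ℂ) + 1) * x ^ (2 * m)))
      (1 / x ^ 2 - Real.pi ^ 2 / Complex.sin (Real.pi * x) ^ 2) := by
  obtain ⟨r, hr0, hr1⟩ := exists_between hx1
  have hrn : 0 ≤ r := (norm_nonneg x).trans hr0.le
  have hder : HasDerivAt (fun y : ℂ => ∑' m : ℕ, -2 * auxZ m * y ^ (2 * m + 1))
      (∑' m : ℕ, -2 * auxZ m * ((2 * (m : ℂ) + 1) * x ^ (2 * m))) x := by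
    refine hasDerivAt_tsum_of_isPreconnected (t := Metric.ball (0 : ℂ) r) (y₀ := 0)
      (g' := fun m y => -2 * auxZ m * ((2 * (m : ℂ) + 1) * y ^ (2 * m)))
      (aux_summable_deriv r hrn hr1) Metric.isOpen_ball (convex_ball _ _).isPreconnected ?_ ?_ ?_ ?_ ?_
    · intro m y _
      have := (hasDerivAt_pow (2 * m + 1) y).const_mul (-2 * auxZ m)
      simpa using this
    · intro m y hy
      exact aux_deriv_bound r y (by simpa using (Metric.mem_ball.mp hy).le) m
    · simpa using (norm_nonneg x).trans_lt hr0
    · simp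
    · simpa using hr0
  have hmem : ∀ y : ℂ, y ≠ 0 → ‖y‖ < 1 → y ∈ Complex.integerComplement := by
    rintro y hy0 hy1 ⟨n, rfl⟩
    have h2 : |(n : ℝ)| < 1 := by simpa using hy1
    have h3 : |n| < 1 := by exact_mod_cast h2
    apply hy0
    have : n = 0 := Int.abs_lt_one_iff.mp h3
    simp [this]
  have hsin := sin_pi_mul_ne_zero (hmem x hx0 hx1)
  have hcot : HasDerivAt (fun y : ℂ => Real.pi * Complex.cot (Real.pi * y) - 1 / y)
      (1 / x ^ 2 - Real.pi ^ 2 / Complex.sin (Real.pi * x) ^ 2) x := by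
    have hm : HasDerivAt (fun y : ℂ => (Real.pi : ℂ) * y) (Real.pi : ℂ) x := by
      simpa using (hasDerivAt_id x).const_mul (Real.pi : ℂ)
    have h1 := ((hm.ccos.fun_div hm.csin hsin).const_mul (Real.pi : ℂ)).sub (hasDerivAt_inv hx0)
    convert! h1 using 1
    · ext y; simp [Complex.cot]
    · have := Complex.sin_sq_add_cos_sq (Real.pi * x)
      generalize Complex.sin (Real.pi * x) = s at *
      generalize Complex.cos (Real.pi * x) = c at *
      field_simp
      linear_combination (x^2 * (Real.pi : ℂ)^2) * this
  have hev : (fun y : ℂ => ∑' m : ℕ, -2 * auxZ m * y ^ (2 * m + 1)) =ᶠ[nhds x]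
      (fun y : ℂ => Real.pi * Complex.cot (Real.pi * y) - 1 / y) := by
    have e1 : ∀ᶠ y in nhds x, y ≠ 0 := isOpen_ne.mem_nhds hx0
    have e2 : ∀ᶠ y in nhds x, ‖y‖ < 1 := continuous_norm.continuousAt.eventually_lt continuousAt_const hx1
    filter_upwards [e1, e2] with y h0 h1
    rw [cot_series_rep' (hmem y h0 h1), aux_cot y h1]
  have heq := (hcot.congr_of_eventuallyEq hev).unique hder
  rw [heq]
  refine Summable.hasSum ?_
  exact Summable.of_norm_bounded (aux_summable_deriv r hrn hr1) (aux_deriv_bound r x hr0.le)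

lemma aux_sin_series' (x : ℂ) (hx0 : x ≠ 0) (hx1 : ‖x‖ < 1) :
    HasSum (fun j : ℕ => 2 * auxZ (j + 1) * ((2 * (j : ℂ) + 3) * x ^ (2 * j + 2)))
      (Real.pi ^ 2 / Complex.sin (Real.pi * x) ^ 2 - 1 / x ^ 2 - Real.pi ^ 2 / 3) := by
  have h := ((hasSum_nat_add_iff' 1).mpr (aux_sin_series x hx0 hx1)).neg
  simp only [Finset.range_one, Finset.sum_singleton] at h
  convert! h using 1
  · ext j
    push_cast
    ring
  · have : auxZ 0 = Real.pi ^ 2 / 6 := by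
      rw [auxZ_eq]
      norm_num [bernoulli_two, Nat.factorial]
      ring
    rw [this]
    simp
    ring

lemma aux_term (τ : ℂ) (hq : ‖qnome τ‖ < 1) (z : ℂ) (j : ℕ) :
    (-1 : ℂ) ^ (j + 2) * (2 * ((j : ℂ) + 2) - 1) * (2 * ((j : ℂ) + 2)) * Ck (j + 2) τ *
          (2 * (Real.pi : ℂ) * z) ^ (2 * (j + 2) - 2) =
      (1 / (4 * (Real.pi : ℂ) ^ 2)) * (2 * auxZ (j + 1) * ((2 * (j : ℂ) + 3) * z ^ (2 * j + 2))) +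
      ∑' kr : ℕ × ℕ, ((kr.1 + 1 : ℕ) : ℂ) * qnome τ ^ ((kr.1 + 1) * (kr.2 + 1)) *
        (2 * ((-1 : ℂ) ^ j * (((kr.1 + 1 : ℕ) : ℂ) * (2 * (Real.pi : ℂ) * z)) ^ (2 * j + 2) /
          ((2 * j + 2).factorial : ℂ))) := by
  have hpi : (Real.pi : ℂ) ≠ 0 := by exact_mod_cast Real.pi_ne_zero
  have hS := (aux_sigma_sum (qnome τ) hq (2 * j + 3)).tsum_eq
  have h1 : ∑' kr : ℕ × ℕ, ((kr.1 + 1 : ℕ) : ℂ) * qnome τ ^ ((kr.1 + 1) * (kr.2 + 1)) *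
        (2 * ((-1 : ℂ) ^ j * (((kr.1 + 1 : ℕ) : ℂ) * (2 * (Real.pi : ℂ) * z)) ^ (2 * j + 2) /
          ((2 * j + 2).factorial : ℂ))) =
      (2 * (-1 : ℂ) ^ j * (2 * (Real.pi : ℂ) * z) ^ (2 * j + 2) / ((2 * j + 2).factorial : ℂ)) *
       ∑' n : ℕ, ((∑ d ∈ (n + 1).divisors, d ^ (2 * j + 3) : ℕ) : ℂ) * qnome τ ^ (n + 1) := by
    rw [← hS, ← tsum_mul_left]
    refine tsum_congr fun kr => ?_
    rw [mul_pow ((kr.1 + 1 : ℕ) : ℂ)]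
    ring
  rw [h1, Ck, Eis, auxZ_eq]
  have e1 : 2 * (j + 2) - 1 = 2 * j + 3 := by omega
  have e2 : 2 * (j + 2) - 2 = 2 * j + 2 := by omega
  have e3 : 2 * (j + 2) = 2 * j + 4 := by omega
  have e4 : 2 * (j + 1) + 2 = 2 * j + 4 := by omega
  have e5 : 2 * (j + 1) + 1 = 2 * j + 3 := by omega
  simp only [sigma', e1, e2]
  simp only [e3, e4, e5]
  have hB : ((bernoulli (2 * j + 4) : ℚ) : ℂ) ≠ 0 := by
    have := aux_bernoulli_ne_zero (j + 1)
    rw [e4] at this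
    exact_mod_cast this
  have hf : ((2 * j + 4).factorial : ℂ) = (2 * (j : ℂ) + 4) * (2 * (j : ℂ) + 3) * ((2 * j + 2).factorial : ℂ) := by
    rw [Nat.factorial_succ, Nat.factorial_succ]
    push_cast
    ring
  have hf0 : ((2 * j + 2).factorial : ℂ) ≠ 0 := by exact_mod_cast Nat.factorial_ne_zero _
  have h3 : (2 * (j : ℂ) + 3) ≠ 0 := by exact_mod_cast (by omega : 2 * j + 3 ≠ 0)
  have h2 : ((j : ℂ) + 2) ≠ 0 := by exact_mod_cast (by omega : j + 2 ≠ 0)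
  have h4 : (2 * (j : ℂ) + 4) = 2 * ((j : ℂ) + 2) := by ring
  rw [hf, h4]
  generalize ∑' n : ℕ, ((∑ d ∈ (n + 1).divisors, d ^ (2 * j + 3) : ℕ) : ℂ) * qnome τ ^ (n + 1) = S
  generalize ((bernoulli (2 * j + 4) : ℚ) : ℂ) = B at *
  generalize ((2 * j + 2).factorial : ℂ) = F at *
  push_cast
  rw [mul_pow, mul_pow, show (2 : ℂ) ^ (2 * j + 3) = 2 * 2 ^ (2 * j + 2) by ring,
    show (Real.pi : ℂ) ^ (2 * j + 4) = Real.pi ^ 2 * Real.pi ^ (2 * j + 2) by ring,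
    pow_add (-1 : ℂ) j 2, pow_succ (-1 : ℂ) j]
  generalize (2 : ℂ) ^ (2 * j + 2) = X
  generalize (Real.pi : ℂ) ^ (2 * j + 2) = Y
  generalize z ^ (2 * j + 2) = Z
  generalize (-1 : ℂ) ^ j = E
  have h5 : 2 * ((j : ℂ) + 2) - 1 = 2 * (j : ℂ) + 3 := by ring
  rw [h5]
  field_simp
  ring

lemma aux_p_cos (z : ℂ) (k : ℕ) :
    pvar z ^ (k + 1) - 2 + ((pvar z)⁻¹) ^ (k + 1) =
      -(2 * (1 - Complex.cos (((k + 1 : ℕ) : ℂ) * (2 * (Real.pi : ℂ) * z)))) := by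
  rw [pvar, ← Complex.exp_neg, ← Complex.exp_nat_mul, ← Complex.exp_nat_mul, Complex.cos]
  rw [show ((k + 1 : ℕ) : ℂ) * (2 * (Real.pi : ℂ) * Complex.I * z) =
      ((k + 1 : ℕ) : ℂ) * (2 * (Real.pi : ℂ) * z) * Complex.I by ring,
    show ((k + 1 : ℕ) : ℂ) * -(2 * (Real.pi : ℂ) * Complex.I * z) =
      -(((k + 1 : ℕ) : ℂ) * (2 * (Real.pi : ℂ) * z)) * Complex.I by ring]
  ring

lemma aux_p_sin (z : ℂ) (hs : Complex.sin (Real.pi * z) ≠ 0) :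
    pvar z / (1 - pvar z) ^ 2 = -(1 / (4 * Complex.sin (Real.pi * z) ^ 2)) := by
  have hp : pvar z = Complex.exp (Real.pi * z * Complex.I) ^ 2 := by
    rw [pvar, ← Complex.exp_nat_mul]
    congr 1
    push_cast
    ring
  have hsin : Complex.sin (Real.pi * z) = (1 - pvar z) * Complex.I /
      (2 * Complex.exp (Real.pi * z * Complex.I)) := by
    rw [Complex.sin, hp, neg_mul, Complex.exp_neg]
    have := Complex.exp_ne_zero (Real.pi * z * Complex.I)
    field_simp
  have h1 : 1 - pvar z ≠ 0 := by
    intro h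
    rw [hsin, h] at hs
    simp at hs
  have := Complex.exp_ne_zero (Real.pi * z * Complex.I)
  rw [hsin, div_pow, mul_pow, Complex.I_sq]
  rw [hp] at h1 ⊢
  field_simp
  norm_num

/-- Two expansions of the Weierstrass `℘`-function agree: for every `τ` in the upper
half-plane there is `ε > 0` such that for every real `z` with `0 < |z| < ε`,
`−1/u² − ∑_{k ≥ 2} (−1)^k (2k−1) 2k C_{2k}(τ) u^{2k−2}
  = 1/12 + p/(1−p)² + ∑_{k,r ≥ 1} k (p^k − 2 + p^{−k}) q^{kr}`,
with `u = 2πz`, both series converging absolutely. -/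
theorem wp_two_expansions_agree (τ : ℂ) (hτ : 0 < τ.im) :
    ∃ ε > 0, ∀ z : ℝ, 0 < |z| → |z| < ε →
      (Summable fun j : ℕ =>
        ‖(-1 : ℂ) ^ (j + 2) * (2 * ((j : ℂ) + 2) - 1) * (2 * ((j : ℂ) + 2)) * Ck (j + 2) τ *
          (2 * (Real.pi : ℂ) * (z : ℂ)) ^ (2 * (j + 2) - 2)‖) ∧
      (Summable fun kr : ℕ × ℕ =>
        ‖((kr.1 + 1 : ℕ) : ℂ) * (pvar z ^ (kr.1 + 1) - 2 + ((pvar z)⁻¹) ^ (kr.1 + 1)) *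
          qnome τ ^ ((kr.1 + 1) * (kr.2 + 1))‖) ∧
      -(1 / (2 * (Real.pi : ℂ) * (z : ℂ)) ^ 2) -
          ∑' j : ℕ, (-1 : ℂ) ^ (j + 2) * (2 * ((j : ℂ) + 2) - 1) * (2 * ((j : ℂ) + 2)) *
            Ck (j + 2) τ * (2 * (Real.pi : ℂ) * (z : ℂ)) ^ (2 * (j + 2) - 2) =
        1 / 12 + pvar z / (1 - pvar z) ^ 2 +
          ∑' kr : ℕ × ℕ,
            ((kr.1 + 1 : ℕ) : ℂ) * (pvar z ^ (kr.1 + 1) - 2 + ((pvar z)⁻¹) ^ (kr.1 + 1)) *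
              qnome τ ^ ((kr.1 + 1) * (kr.2 + 1)) := by
  have hqn : ‖qnome τ‖ = Real.exp (-(2 * Real.pi * τ.im)) := by
    rw [qnome, Complex.norm_exp]
    congr 1
    simp [Complex.mul_re, Complex.mul_im]
  have hq : ‖qnome τ‖ < 1 := by
    rw [hqn, Real.exp_lt_one_iff]
    have := Real.pi_pos
    have : 0 < 2 * Real.pi * τ.im := by positivity
    linarith
  refine ⟨min 1 τ.im, lt_min one_pos hτ, fun z hz0 hz => ?_⟩
  have hz1 : |z| < 1 := hz.trans_le (min_le_left _ _)
  have hz2 : |z| < τ.im := hz.trans_le (min_le_right _ _)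
  have hx0 : (z : ℂ) ≠ 0 := by exact_mod_cast abs_pos.mp hz0
  have hx1 : ‖(z : ℂ)‖ < 1 := by simpa using hz1
  have hu : ‖2 * (Real.pi : ℂ) * (z : ℂ)‖ = 2 * Real.pi * |z| := by
    simp [abs_of_pos Real.pi_pos]
  have huq : Real.exp ‖2 * (Real.pi : ℂ) * (z : ℂ)‖ * ‖qnome τ‖ < 1 := by
    rw [hu, hqn, ← Real.exp_add, Real.exp_lt_one_iff]
    have := mul_lt_mul_of_pos_left hz2 (by positivity : 0 < 2 * Real.pi)
    linarith
  have hpi : (Real.pi : ℂ) ≠ 0 := by exact_mod_cast Real.pi_ne_zero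
  have hsin : Complex.sin (Real.pi * z) ≠ 0 := by
    apply sin_pi_mul_ne_zero
    rintro ⟨n, hn⟩
    rw [← hn] at hx0 hx1
    have h2 : |(n : ℝ)| < 1 := by simpa using hx1
    have h3 : |n| < 1 := by exact_mod_cast h2
    apply hx0
    simp [Int.abs_lt_one_iff.mp h3]
  have hG := (aux_double (qnome τ) (2 * (Real.pi : ℂ) * (z : ℂ)) hq huq).of_norm
  have hrow : ∀ kr : ℕ × ℕ, HasSum (fun j : ℕ =>
      ((kr.1 + 1 : ℕ) : ℂ) * qnome τ ^ ((kr.1 + 1) * (kr.2 + 1)) *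
        (2 * ((-1 : ℂ) ^ j * (((kr.1 + 1 : ℕ) : ℂ) * (2 * (Real.pi : ℂ) * z)) ^ (2 * j + 2) /
          ((2 * j + 2).factorial : ℂ))))
      (-(((kr.1 + 1 : ℕ) : ℂ) * (pvar z ^ (kr.1 + 1) - 2 + ((pvar z)⁻¹) ^ (kr.1 + 1)) *
              qnome τ ^ ((kr.1 + 1) * (kr.2 + 1)))) := by
    intro kr
    have := ((aux_hasSum_cos_sub (((kr.1 + 1 : ℕ) : ℂ) * (2 * (Real.pi : ℂ) * z))).mul_left 2).mul_left
      (((kr.1 + 1 : ℕ) : ℂ) * qnome τ ^ ((kr.1 + 1) * (kr.2 + 1)))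
    convert! this using 1
    rw [aux_p_cos]
    ring
  have hA := (aux_sin_series' z hx0 hx1).mul_left (1 / (4 * (Real.pi : ℂ) ^ 2))
  have hkr := (hG.hasSum.prod_fiberwise hrow)
  have hGs := (Equiv.prodComm ℕ (ℕ × ℕ)).summable_iff.mpr hG
  have hB := (((Equiv.prodComm ℕ (ℕ × ℕ)).hasSum_iff.mpr hG.hasSum).prod_fiberwise
    (fun j => (hGs.prod_factor j).hasSum))
  have hT := hA.add hB
  have hT' := hT.congr_fun fun j => aux_term τ hq z j
  refine ⟨summable_norm_iff.mpr hT'.summable, ?_, ?_⟩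
  · have := hkr.summable.neg
    simp only [neg_neg] at this
    exact summable_norm_iff.mpr this
  · have h1 := hkr.neg
    simp only [neg_neg] at h1
    rw [hT'.tsum_eq, h1.tsum_eq, aux_p_sin _ hsin]
    generalize Complex.sin (Real.pi * z) = s at *
    field_simp
    ring

end
end

section
/- The Katz–Klemm–Vafa exponential form of 1/(F²Δ): for every τ in the upper half-plane ℍ there exists ε > 0 such that for every real z with 0 < |z| < ε one has 1/(F(z,τ)² · Δ(τ)) = (1/(u² Δ(τ))) · exp( Σ_{k≥1} u^{2k} · (|B_{2k}|/(k·(2k)!)) · E_{2k}(τ) ), where u = 2πz and |B_{2k}| denotes the absolute value of the Bernoulli number B_{2k}. -/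
open Complex

noncomputable section

/-- The discriminant `Δ(τ) = q ∏_{n ≥ 1} (1 − q^n)^24`. -/
def Disc (τ : ℂ) : ℂ := qnome τ * ∏' n : ℕ, (1 - qnome τ ^ (n + 1)) ^ 24

lemma fubini_aux {α β : Type*} {f : α × β → ℂ} (hf : Summable f) {g : α → ℂ} {h : β → ℂ}
    (hg : ∀ a, HasSum (fun b => f (a, b)) (g a)) (hh : ∀ b, HasSum (fun a => f (a, b)) (h b)) :
    ∃ S, HasSum g S ∧ HasSum h S := by
  refine ⟨∑' x, f x, hf.hasSum.prod_fiberwise hg, ?_⟩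
  have h2 : HasSum (f ∘ (Equiv.prodComm β α)) (∑' x, f x) :=
    (Equiv.prodComm β α).hasSum_iff.mpr hf.hasSum
  exact h2.prod_fiberwise hh

lemma zeta_pos_aux (k : ℕ) :
    0 < (-1 : ℝ) ^ k * (bernoulli (2 * (k + 1)) : ℝ) ∧
    HasSum (fun j : ℕ => 1 / ((j : ℝ) + 1) ^ (2 * (k + 1)))
      ((2 * Real.pi) ^ (2 * (k + 1)) * ((-1 : ℝ) ^ k * (bernoulli (2 * (k + 1)) : ℝ)) /
        (2 * ((2 * (k + 1)).factorial : ℝ))) := by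
  have h := hasSum_zeta_nat (k := k + 1) (by omega)
  rw [← hasSum_nat_add_iff' 1] at h
  have h2 : HasSum (fun j : ℕ => 1 / ((j : ℝ) + 1) ^ (2 * (k + 1)))
      ((2 * Real.pi) ^ (2 * (k + 1)) * ((-1 : ℝ) ^ k * (bernoulli (2 * (k + 1)) : ℝ)) /
        (2 * ((2 * (k + 1)).factorial : ℝ))) := by
    convert! h using 1
    · ext j; push_cast; rfl
    · have e1 : 2 * (k + 1) - 1 = 2 * k + 1 := by omega
      have e2 : (2 : ℝ) ^ (2 * (k + 1)) = 2 ^ (2 * k + 1) * 2 := by ring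
      rw [e1, mul_pow, e2]
      simp
      field_simp
      ring
  refine ⟨?_, h2⟩
  have h3 : 0 < (2 * Real.pi) ^ (2 * (k + 1)) * ((-1 : ℝ) ^ k * (bernoulli (2 * (k + 1)) : ℝ)) /
        (2 * ((2 * (k + 1)).factorial : ℝ)) := by
    rw [← h2.tsum_eq]
    exact h2.summable.tsum_pos (fun j => by positivity) 0 (by norm_num)
  have hp := Real.pi_pos
  by_contra hc
  push Not at hc
  have : (2 * Real.pi) ^ (2 * (k + 1)) * ((-1 : ℝ) ^ k * (bernoulli (2 * (k + 1)) : ℝ)) /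
        (2 * ((2 * (k + 1)).factorial : ℝ)) ≤ 0 :=
    div_nonpos_of_nonpos_of_nonneg (mul_nonpos_of_nonneg_of_nonpos (by positivity) hc)
      (by positivity)
  linarith

lemma bern_ne (k : ℕ) : bernoulli (2 * (k + 1)) ≠ 0 := by
  intro h
  have := (zeta_pos_aux k).1
  simp [h] at this

lemma bern_abs (k : ℕ) :
    |bernoulli (2 * (k + 1))| = (-1) ^ k * bernoulli (2 * (k + 1)) := by
  have h := (zeta_pos_aux k).1
  have h' : (0 : ℚ) < (-1) ^ k * bernoulli (2 * (k + 1)) := by exact_mod_cast h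
  rw [← abs_of_pos h', abs_mul]; simp

/-- The constant-term summand. -/
def Aterm (z : ℝ) (k : ℕ) : ℂ := (2 * (Real.pi : ℂ) * (z : ℂ)) ^ (2 * (k + 1)) *
  ((|bernoulli (2 * (k + 1))| : ℚ) : ℂ) / (((k : ℂ) + 1) * ((2 * (k + 1)).factorial : ℂ))

lemma sin_part (z : ℝ) (hz : |z| < 1) :
    ∃ a, HasSum (Aterm z) a ∧
      (2 * (Real.pi : ℂ) * (z : ℂ)) ^ 2 * cexp (-a) = (2 * Complex.sin (Real.pi * z)) ^ 2 := by
  have hz2 : z ^ 2 < 1 := (sq_lt_one_iff_abs_lt_one z).mpr hz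
  have hsum : Summable (fun x : ℕ × ℕ =>
      2 * (((z : ℂ) ^ 2 / ((x.1 : ℂ) + 1) ^ 2) ^ (x.2 + 1) / ((x.2 : ℂ) + 1))) := by
    have hb : Summable (fun x : ℕ × ℕ => (2 / ((x.1 : ℝ) + 1) ^ 2) * (z ^ 2) ^ x.2) := by
      refine Summable.mul_of_nonneg (f := fun j : ℕ => 2 / ((j : ℝ) + 1) ^ 2)
        (g := fun k : ℕ => (z ^ 2) ^ k) ?_ ?_ ?_ ?_
      · have := (summable_nat_add_iff 1).mpr (Real.summable_one_div_nat_pow.mpr (one_lt_two))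
        simpa [div_eq_mul_inv] using this.mul_left 2
      · exact summable_geometric_of_lt_one (by positivity) hz2
      · intro i; simp only [Pi.zero_apply]; positivity
      · intro i; simp only [Pi.zero_apply]; positivity
    refine Summable.of_norm_bounded hb ?_
    rintro ⟨j, k⟩
    have e : ‖2 * (((z : ℂ) ^ 2 / ((j : ℂ) + 1) ^ 2) ^ (k + 1) / ((k : ℂ) + 1))‖
        = 2 * ((z ^ 2 / ((j : ℝ) + 1) ^ 2) ^ (k + 1) / ((k : ℝ) + 1)) := by
      have : (2 * (((z : ℂ) ^ 2 / ((j : ℂ) + 1) ^ 2) ^ (k + 1) / ((k : ℂ) + 1)))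
        = ((2 * ((z ^ 2 / ((j : ℝ) + 1) ^ 2) ^ (k + 1) / ((k : ℝ) + 1)) : ℝ) : ℂ) := by
        push_cast; rfl
      rw [this, Complex.norm_real, Real.norm_of_nonneg (by positivity)]
    simp only
    rw [e]
    have h1 : (z ^ 2 / ((j : ℝ) + 1) ^ 2) ^ (k + 1) / ((k : ℝ) + 1) ≤
        (z ^ 2 / ((j : ℝ) + 1) ^ 2) ^ (k + 1) := div_le_self (by positivity) (by simp)
    have h2 : (z ^ 2 / ((j : ℝ) + 1) ^ 2) ^ (k + 1) =
        (z ^ 2) ^ k * (z ^ 2) * (1 / ((j : ℝ) + 1) ^ 2) * (1 / ((j : ℝ) + 1) ^ 2) ^ k := by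
      rw [div_eq_mul_one_div, mul_pow]; ring
    have hj : 1 / ((j : ℝ) + 1) ^ 2 ≤ 1 := by
      rw [div_le_one (by positivity)]
      nlinarith [(Nat.cast_nonneg j : (0 : ℝ) ≤ j)]
    have h3 : (1 / ((j : ℝ) + 1) ^ 2) ^ k ≤ 1 := pow_le_one₀ (by positivity) hj
    have h4 : (z ^ 2) ^ k * (z ^ 2) * (1 / ((j : ℝ) + 1) ^ 2) * (1 / ((j : ℝ) + 1) ^ 2) ^ k
        ≤ (z ^ 2) ^ k * 1 * (1 / ((j : ℝ) + 1) ^ 2) * 1 := by gcongr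
    calc _ ≤ 2 * ((z ^ 2) ^ k * 1 * (1 / ((j : ℝ) + 1) ^ 2) * 1) := by
            rw [← h2] at h4; linarith
      _ = _ := by ring
  have hlt : ∀ j : ℕ, ‖(z : ℂ) ^ 2 / ((j : ℂ) + 1) ^ 2‖ < 1 := by
    intro j
    have : (z : ℂ) ^ 2 / ((j : ℂ) + 1) ^ 2 = ((z ^ 2 / ((j : ℝ) + 1) ^ 2 : ℝ) : ℂ) := by
      push_cast; rfl
    rw [this, Complex.norm_real, Real.norm_of_nonneg (by positivity), div_lt_one (by positivity)]
    nlinarith [(Nat.cast_nonneg j : (0 : ℝ) ≤ j)]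
  obtain ⟨S, hS1, hS2⟩ := fubini_aux hsum
    (g := fun j => 2 * (-Complex.log (1 - (z : ℂ) ^ 2 / ((j : ℂ) + 1) ^ 2))) (h := Aterm z)
    (fun j => (hasSum_taylorSeries_neg_log' (hlt j)).mul_left 2)
    (fun k => by
      have h := (Complex.hasSum_ofReal.mpr (zeta_pos_aux k).2).mul_left
        (2 * (z : ℂ) ^ (2 * (k + 1)) / ((k : ℂ) + 1))
      convert! h using 1
      · ext j
        push_cast
        rw [div_pow, ← pow_mul, ← pow_mul]
        ring
      · have hk : (k : ℂ) + 1 ≠ 0 := by exact_mod_cast Nat.succ_ne_zero k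
        have hf : ((2 * (k + 1)).factorial : ℂ) ≠ 0 := by exact_mod_cast Nat.factorial_ne_zero _
        rw [Aterm, bern_abs, mul_pow]
        push_cast
        field_simp)
  refine ⟨S, hS2, ?_⟩
  have hT := (hS1.neg.cexp).tendsto_prod_nat
  have hE := (Complex.tendsto_euler_sin_prod z).const_mul 2 |>.pow 2
  refine tendsto_nhds_unique (hT.const_mul ((2 * (Real.pi : ℂ) * (z : ℂ)) ^ 2)) ?_
  refine hE.congr fun n => ?_
  have : ∀ j : ℕ, (cexp ∘ fun b : ℕ => -(2 * -Complex.log (1 - (z : ℂ) ^ 2 / ((b : ℂ) + 1) ^ 2))) j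
      = (1 - (z : ℂ) ^ 2 / ((j : ℂ) + 1) ^ 2) ^ 2 := by
    intro j
    have hne : (1 - (z : ℂ) ^ 2 / ((j : ℂ) + 1) ^ 2) ≠ 0 := by
      intro h0
      have := hlt j
      rw [← sub_eq_zero.mp h0] at this
      simp at this
    simp only [Function.comp]
    rw [show -(2 * -Complex.log (1 - (z : ℂ) ^ 2 / ((j : ℂ) + 1) ^ 2)) =
      Complex.log (1 - (z : ℂ) ^ 2 / ((j : ℂ) + 1) ^ 2) +
      Complex.log (1 - (z : ℂ) ^ 2 / ((j : ℂ) + 1) ^ 2) by ring, Complex.exp_add,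
      Complex.exp_log hne]
    ring
  rw [Finset.prod_congr rfl (fun j _ => this j), Finset.prod_pow]
  ring

/-- the triple series term -/
def gterm (q : ℂ) (u : ℝ) (x : (ℕ × ℕ) × ℕ) : ℂ :=
  q ^ ((x.1.1 + 1) * (x.1.2 + 1)) / ((x.1.2 : ℂ) + 1) *
    (2 * ((-1) ^ (x.2 + 1) * ((u : ℂ) * ((x.1.2 : ℂ) + 1)) ^ (2 * (x.2 + 1)) /
      ((2 * (x.2 + 1)).factorial : ℂ)))

lemma cosh_tail (r : ℝ) : HasSum (fun k : ℕ => r ^ (2 * (k + 1)) / ((2 * (k + 1)).factorial : ℝ))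
    (Real.cosh r - 1) := by
  have h := Real.hasSum_cosh r
  rw [← hasSum_nat_add_iff' 1] at h
  simpa using h

lemma cos_tail (r : ℂ) : HasSum (fun k : ℕ => (-1) ^ (k + 1) * r ^ (2 * (k + 1)) /
    ((2 * (k + 1)).factorial : ℂ)) (Complex.cos r - 1) := by
  have h := Complex.hasSum_cos r
  rw [← hasSum_nat_add_iff' 1] at h
  simpa using h

lemma gterm_summable (q : ℂ) (u : ℝ) (hq : ‖q‖ < 1) (hqu : ‖q‖ * Real.exp |u| < 1) :
    Summable (gterm q u) := by
  have h1 : Summable (fun x : ℕ × ℕ => ‖q‖ ^ (x.1 + 1) *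
      (2 * ((|u| * ((x.1 : ℝ) + 1)) ^ (2 * (x.2 + 1)) / ((2 * (x.2 + 1)).factorial : ℝ)))) := by
    have hs : ∀ d : ℕ, HasSum (fun k : ℕ => ‖q‖ ^ (d + 1) *
      (2 * ((|u| * ((d : ℝ) + 1)) ^ (2 * (k + 1)) / ((2 * (k + 1)).factorial : ℝ))))
      (‖q‖ ^ (d + 1) * (2 * (Real.cosh (|u| * ((d : ℝ) + 1)) - 1))) := fun d =>
        ((cosh_tail _).mul_left 2).mul_left _
    rw [summable_prod_of_nonneg (fun x => by simp only [Pi.zero_apply]; positivity)]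
    refine ⟨fun d => (hs d).summable, ?_⟩
    simp only [fun d => (hs d).tsum_eq]
    have hgeo : Summable (fun d : ℕ => 2 * (‖q‖ * Real.exp |u|) ^ (d + 1)) :=
      ((summable_nat_add_iff 1).mpr
        (summable_geometric_of_lt_one (by positivity) hqu)).mul_left 2
    refine Summable.of_nonneg_of_le (fun d => ?_) (fun d => ?_) hgeo
    · have := Real.one_le_cosh (|u| * ((d : ℝ) + 1))
      have h' : 0 ≤ Real.cosh (|u| * ((d : ℝ) + 1)) - 1 := by linarith
      positivity
    · have e1 : (‖q‖ * Real.exp |u|) ^ (d + 1) =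
          ‖q‖ ^ (d + 1) * Real.exp (|u| * ((d : ℝ) + 1)) := by
        rw [mul_pow, ← Real.exp_nat_mul]; push_cast; ring_nf
      have e2 : Real.cosh (|u| * ((d : ℝ) + 1)) - 1 ≤ Real.exp (|u| * ((d : ℝ) + 1)) := by
        rw [Real.cosh_eq]
        have : Real.exp (-(|u| * ((d : ℝ) + 1))) ≤ 1 := by
          rw [Real.exp_le_one_iff]
          have : 0 ≤ |u| * ((d : ℝ) + 1) := by positivity
          linarith
        have := Real.exp_pos (|u| * ((d : ℝ) + 1))
        linarith
      rw [e1]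
      calc _ ≤ ‖q‖ ^ (d + 1) * (2 * Real.exp (|u| * ((d : ℝ) + 1))) := by gcongr
        _ = _ := by ring
  have h2 : Summable (fun m : ℕ => ‖q‖ ^ m) := summable_geometric_of_lt_one (by positivity) hq
  have h3 := Summable.mul_of_nonneg h2 h1
    (fun x => by simp only [Pi.zero_apply]; positivity)
    (fun x => by simp only [Pi.zero_apply]; positivity)
  have h4 := (Equiv.prodAssoc ℕ ℕ ℕ).summable_iff.mpr h3
  refine Summable.of_norm_bounded h4 ?_
  rintro ⟨⟨m, d⟩, k⟩
  have hd : ‖((d : ℂ) + 1)‖ = (d : ℝ) + 1 := by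
    have : ((d : ℂ) + 1) = (((d : ℝ) + 1 : ℝ) : ℂ) := by push_cast; rfl
    rw [this, Complex.norm_real, Real.norm_of_nonneg (by positivity)]
  simp only [gterm, Function.comp, Equiv.prodAssoc_apply]
  simp only [norm_mul, norm_div, norm_pow, norm_neg, norm_one, one_pow, one_mul,
    Complex.norm_real, Real.norm_eq_abs, hd, Complex.norm_natCast, Complex.norm_ofNat]
  rw [← mul_assoc (‖q‖ ^ m)]
  gcongr
  calc ‖q‖ ^ ((m + 1) * (d + 1)) / ((d : ℝ) + 1) ≤ ‖q‖ ^ ((m + 1) * (d + 1)) :=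
        div_le_self (by positivity) (by simp)
    _ ≤ ‖q‖ ^ (m + (d + 1)) :=
        pow_le_pow_of_le_one (by positivity) hq.le (by nlinarith)
    _ = _ := by rw [pow_add]

lemma sigma_sum (q : ℂ) (hq : ‖q‖ < 1) (k : ℕ) :
    HasSum (fun x : ℕ × ℕ => ((x.2 : ℂ) + 1) ^ k * q ^ ((x.1 + 1) * (x.2 + 1)))
      (∑' n : ℕ, (sigma' k (n + 1) : ℂ) * q ^ (n + 1)) := by
  have hs := summable_prod_mul_pow k hq
  have h1 := tsum_prod_pow_eq_tsum_sigma k hq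
  rw [tsum_pnat_eq_tsum_succ (f := fun n : ℕ => (ArithmeticFunction.sigma k n : ℂ) * q ^ n)] at h1
  have h2 := hs.hasSum
  rw [hs.tsum_prod] at h2
  rw [h1] at h2
  have h3 := ((Equiv.pnatEquivNat.symm.prodCongr Equiv.pnatEquivNat.symm).hasSum_iff).mpr h2
  convert! h3 using 1
  · ext ⟨m, d⟩
    simp [Equiv.pnatEquivNat]

set_option maxHeartbeats 1600000 in
lemma prod_part (q : ℂ) (u : ℝ) (hq : ‖q‖ < 1) (hqu : ‖q‖ * Real.exp |u| < 1) :
    ∃ S, HasSum (fun k : ℕ => 2 * ((-1) ^ (k + 1) * (u : ℂ) ^ (2 * (k + 1)) /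
      ((2 * (k + 1)).factorial : ℂ)) *
        ∑' n : ℕ, (sigma' (2 * (k + 1) - 1) (n + 1) : ℂ) * q ^ (n + 1)) S ∧
      HasProd (fun m : ℕ => ((1 - cexp (u * I) * q ^ (m + 1)) *
        (1 - (cexp (u * I))⁻¹ * q ^ (m + 1)) / (1 - q ^ (m + 1)) ^ 2)) (cexp (-S)) := by
  have hd : ∀ d : ℕ, (d : ℂ) + 1 ≠ 0 := fun d => by exact_mod_cast Nat.succ_ne_zero d
  obtain ⟨S, hS1, hS2⟩ := fubini_aux (gterm_summable q u hq hqu)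
    (g := fun x => q ^ ((x.1 + 1) * (x.2 + 1)) / ((x.2 : ℂ) + 1) *
      (2 * (Complex.cos ((u : ℂ) * ((x.2 : ℂ) + 1)) - 1)))
    (h := fun k : ℕ => 2 * ((-1) ^ (k + 1) * (u : ℂ) ^ (2 * (k + 1)) /
      ((2 * (k + 1)).factorial : ℂ)) *
        ∑' n : ℕ, (sigma' (2 * (k + 1) - 1) (n + 1) : ℂ) * q ^ (n + 1))
    (fun x => ((cos_tail _).mul_left 2).mul_left _)
    (fun k => by
      have h := (sigma_sum q hq (2 * (k + 1) - 1)).mul_left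
        (2 * ((-1) ^ (k + 1) * (u : ℂ) ^ (2 * (k + 1)) / ((2 * (k + 1)).factorial : ℂ)))
      convert! h using 1
      ext ⟨m, d⟩
      have e : 2 * (k + 1) - 1 = 2 * k + 1 := by omega
      have := hd d
      have hf : ((2 * (k + 1)).factorial : ℂ) ≠ 0 := by exact_mod_cast Nat.factorial_ne_zero _
      simp only [gterm, e]
      have e3 : ((u : ℂ) * ((d : ℂ) + 1)) ^ (2 * (k + 1)) =
        (u : ℂ) ^ (2 * (k + 1)) * (((d : ℂ) + 1) ^ (2 * k + 1) * ((d : ℂ) + 1)) := by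
        rw [mul_pow]; ring
      rw [e3]
      field_simp)
  refine ⟨S, hS2, ?_⟩
  have hpn : ‖cexp (u * I)‖ = 1 := Complex.norm_exp_ofReal_mul_I u
  have hqm : ∀ m : ℕ, ‖q ^ (m + 1)‖ < 1 := fun m => by
    rw [norm_pow]; exact pow_lt_one₀ (norm_nonneg _) hq (by omega)
  have hn1 : ∀ m : ℕ, ‖cexp (u * I) * q ^ (m + 1)‖ < 1 := fun m => by
    rw [norm_mul, hpn, one_mul]; exact hqm m
  have hn2 : ∀ m : ℕ, ‖(cexp (u * I))⁻¹ * q ^ (m + 1)‖ < 1 := fun m => by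
    rw [norm_mul, norm_inv, hpn, inv_one, one_mul]; exact hqm m
  have hne : ∀ w : ℂ, ‖w‖ < 1 → 1 - w ≠ 0 := by
    intro w hw h0
    rw [← sub_eq_zero.mp h0] at hw
    simp at hw
  have hm := hS1.prod_fiberwise (g := fun m : ℕ =>
    -Complex.log (1 - cexp (u * I) * q ^ (m + 1)) +
    -Complex.log (1 - (cexp (u * I))⁻¹ * q ^ (m + 1)) -
      2 * (-Complex.log (1 - q ^ (m + 1)))) (fun m => by
    have h := ((hasSum_taylorSeries_neg_log' (hn1 m)).add
      (hasSum_taylorSeries_neg_log' (hn2 m))).sub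
      ((hasSum_taylorSeries_neg_log' (hqm m)).mul_left 2)
    convert! h using 1
    ext d
    have e1 : 2 * Complex.cos ((u : ℂ) * ((d : ℂ) + 1)) =
        cexp (u * I) ^ (d + 1) + (cexp (u * I))⁻¹ ^ (d + 1) := by
      rw [Complex.two_cos, ← Complex.exp_neg, ← Complex.exp_nat_mul, ← Complex.exp_nat_mul]
      push_cast
      congr 2 <;> ring
    rw [mul_sub, e1, mul_pow, mul_pow, ← pow_mul]
    ring)
  convert! hm.neg.cexp using 1
  ext m
  have a1 := hne _ (hn1 m)
  have a2 := hne _ (hn2 m)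
  have a3 := hne _ (hqm m)
  simp only [Function.comp]
  rw [show -(-Complex.log (1 - cexp (u * I) * q ^ (m + 1)) +
    -Complex.log (1 - (cexp (u * I))⁻¹ * q ^ (m + 1)) -
      2 * (-Complex.log (1 - q ^ (m + 1)))) =
      Complex.log (1 - cexp (u * I) * q ^ (m + 1)) +
      Complex.log (1 - (cexp (u * I))⁻¹ * q ^ (m + 1)) -
      (Complex.log (1 - q ^ (m + 1)) + Complex.log (1 - q ^ (m + 1))) by ring,
    Complex.exp_sub, Complex.exp_add, Complex.exp_add, Complex.exp_log a1, Complex.exp_log a2,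
    Complex.exp_log a3, sq]

/-- The Katz–Klemm–Vafa exponential form of `1/(F²Δ)`: for every `τ` in the upper half-plane
there is `ε > 0` such that for all real `z` with `0 < |z| < ε`,
`1/(F(z,τ)²Δ(τ)) = (1/(u²Δ(τ))) exp(∑_{k ≥ 1} u^{2k} (|B_{2k}|/(k·(2k)!)) E_{2k}(τ))`,
where `u = 2πz`. -/
theorem KKV_exponential_form (τ : ℂ) (hτ : 0 < τ.im) :
    ∃ ε > 0, ∀ z : ℝ, 0 < |z| → |z| < ε →
      1 / ((Fth z τ) ^ 2 * Disc τ) =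
        (1 / ((2 * (Real.pi : ℂ) * (z : ℂ)) ^ 2 * Disc τ)) *
          Complex.exp (∑' k : ℕ,
            (2 * (Real.pi : ℂ) * (z : ℂ)) ^ (2 * (k + 1)) *
              ((|bernoulli (2 * (k + 1))| : ℚ) : ℂ) /
                (((k : ℂ) + 1) * ((2 * (k + 1)).factorial : ℂ)) * Eis (k + 1) τ) := by
  have hpi := Real.pi_pos
  have hqn : ‖qnome τ‖ = Real.exp (-(2 * Real.pi * τ.im)) := by
    rw [qnome, Complex.norm_exp]
    congr 1
    simp [Complex.mul_re, Complex.mul_im]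
  have hq : ‖qnome τ‖ < 1 := by
    rw [hqn, Real.exp_lt_one_iff]
    have : 0 < 2 * Real.pi * τ.im := by positivity
    linarith
  refine ⟨min 1 τ.im, lt_min one_pos hτ, fun z hz0 hz => ?_⟩
  have hz1 : |z| < 1 := lt_of_lt_of_le hz (min_le_left _ _)
  have hz2 : |z| < τ.im := lt_of_lt_of_le hz (min_le_right _ _)
  have hqu : ‖qnome τ‖ * Real.exp |2 * Real.pi * z| < 1 := by
    rw [hqn, ← Real.exp_add, Real.exp_lt_one_iff, abs_mul, abs_of_pos (by positivity)]
    have : 2 * Real.pi * |z| < 2 * Real.pi * τ.im := by gcongr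
    linarith
  obtain ⟨a, ha, hsin⟩ := sin_part z hz1
  obtain ⟨S, hS, hP⟩ := prod_part (qnome τ) (2 * Real.pi * z) hq hqu
  have hsum : HasSum (fun k : ℕ => (2 * (Real.pi : ℂ) * (z : ℂ)) ^ (2 * (k + 1)) *
              ((|bernoulli (2 * (k + 1))| : ℚ) : ℂ) /
                (((k : ℂ) + 1) * ((2 * (k + 1)).factorial : ℂ)) * Eis (k + 1) τ) (a + 2 * S) := by
    convert! ha.add (hS.mul_left 2) using 1
    ext k
    have hk : (k : ℂ) + 1 ≠ 0 := by exact_mod_cast Nat.succ_ne_zero k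
    have hf : ((2 * (k + 1)).factorial : ℂ) ≠ 0 := by exact_mod_cast Nat.factorial_ne_zero _
    have hb : ((bernoulli (2 * (k + 1)) : ℚ) : ℂ) ≠ 0 := by exact_mod_cast bern_ne k
    simp only [Aterm, Eis]
    rw [bern_abs]
    generalize (∑' n : ℕ, (sigma' (2 * (k + 1) - 1) (n + 1) : ℂ) * qnome τ ^ (n + 1)) = T
    push_cast
    rw [mul_sub, mul_one, sub_eq_add_neg]
    congr 1
    field_simp
    ring
  rw [hsum.tsum_eq]
  have hF : Fth z τ = 2 * Complex.sin (Real.pi * z) * cexp (-S) := by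
    have hp : pvar z = cexp (((2 * Real.pi * z : ℝ) : ℂ) * I) := by
      rw [pvar]; congr 1; push_cast; ring
    rw [Fth, hp, hP.tprod_eq]
    congr 1
    rw [Complex.two_sin]
    rw [show -((Real.pi : ℂ) * z) * I = -(Real.pi * I * z) by ring,
      show ((Real.pi : ℂ) * z) * I = Real.pi * I * z by ring]
    ring
  have hF2 : Fth z τ ^ 2 = (2 * (Real.pi : ℂ) * (z : ℂ)) ^ 2 * cexp (-(a + 2 * S)) := by
    rw [hF, mul_pow, ← hsin, mul_assoc, sq (cexp (-S)), ← Complex.exp_add, ← Complex.exp_add]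
    congr 2
    ring
  rw [hF2, Complex.exp_neg]
  simp only [one_div, mul_inv, inv_inv]
  ring

end
end
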